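/- Let T>0 be fixed, and let α(t) and β(t) be locally integrable real-valued functions on (0,∞) satisfying: liminf_{t→∞} (1/T)∫_t^{t+T} α(τ)dτ = m > 0, limsup_{t→∞} (1/T)∫_t^{t+T} α⁻(τ)dτ = M < ∞, and lim_{t→∞} (1/T)∫_t^{t+T} β⁺(τ)dτ = 0, where α⁻ = max{−α, 0} and β⁺ = max{β, 0}. If y(t) is an absolutely continuous nonnegative function on (0,∞) satisfying y'(t) + α(t)y(t) ≤ β(t) almost everywhere on (0,∞), then lim_{t→∞} y(t) = 0. -/

import Mathlib

open MeasureTheory Filter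

/-- Composing an absolutely continuous function with a Lipschitz function. -/
theorem AbsolutelyContinuousOnInterval.lipschitzOnWith_comp {f g : ℝ → ℝ} {a b : ℝ} {K : NNReal}
    {S : Set ℝ} (hf : AbsolutelyContinuousOnInterval f a b) (hg : LipschitzOnWith K g S)
    (hS : Set.MapsTo f (Set.uIcc a b) S) :
    AbsolutelyContinuousOnInterval (fun x ↦ g (f x)) a b := by
  rw [absolutelyContinuousOnInterval_iff] at hf ⊢
  intro ε hε
  obtain ⟨δ, hδ, h⟩ := hf (ε / (K + 1)) (by positivity)
  refine ⟨δ, hδ, fun E hE hlen ↦ ?_⟩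
  have hmem : ∀ i ∈ Finset.range E.1, (E.2 i).1 ∈ Set.uIcc a b ∧ (E.2 i).2 ∈ Set.uIcc a b := hE.1
  have hsum := h E hE hlen
  rw [lt_div_iff₀ (by positivity)] at hsum
  calc ∑ i ∈ Finset.range E.1, dist (g (f (E.2 i).1)) (g (f (E.2 i).2))
      ≤ ∑ i ∈ Finset.range E.1, K * dist (f (E.2 i).1) (f (E.2 i).2) :=
        Finset.sum_le_sum fun i hi ↦
          hg.dist_le_mul _ (hS (hmem i hi).1) _ (hS (hmem i hi).2)
    _ = K * ∑ i ∈ Finset.range E.1, dist (f (E.2 i).1) (f (E.2 i).2) := by rw [Finset.mul_sum]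
    _ ≤ (∑ i ∈ Finset.range E.1, dist (f (E.2 i).1) (f (E.2 i).2)) * (K + 1) := by
        have : 0 ≤ ∑ i ∈ Finset.range E.1, dist (f (E.2 i).1) (f (E.2 i).2) :=
          Finset.sum_nonneg fun i _ ↦ dist_nonneg
        nlinarith
    _ < ε := hsum

/-- The exponential of an absolutely continuous function is absolutely continuous. -/
theorem AbsolutelyContinuousOnInterval.exp {f : ℝ → ℝ} {a b : ℝ}
    (hf : AbsolutelyContinuousOnInterval f a b) :
    AbsolutelyContinuousOnInterval (fun x ↦ Real.exp (f x)) a b := by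
  obtain ⟨C, hC⟩ := hf.exists_bound
  obtain ⟨K, hK⟩ := (Real.contDiff_exp (n := 1)).contDiffOn.exists_lipschitzOnWith (by decide)
    (convex_Icc (-C) C) isCompact_Icc
  exact hf.lipschitzOnWith_comp hK fun x hx ↦ abs_le.1 (hC x hx)

/-- Gronwall's inequality on a compact interval, with an integrable coefficient whose integrals
over terminal segments are bounded below. -/
theorem le_exp_mul_add_of_ae_deriv_add_mul_le {s t C : ℝ} (hst : s ≤ t) {α β y y' : ℝ → ℝ}
    (hα : IntervalIntegrable α volume s t) (hβ : IntervalIntegrable β volume s t)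
    (hy' : IntervalIntegrable y' volume s t)
    (hy : ∀ u ∈ Set.Icc s t, y u - y s = ∫ τ in s..u, y' τ)
    (hineq : ∀ᵐ u, u ∈ Set.Icc s t → y' u + α u * y u ≤ β u)
    (hC : ∀ u ∈ Set.Icc s t, -∫ τ in u..t, α τ ≤ C) :
    y t ≤ Real.exp (-∫ τ in s..t, α τ) * y s + Real.exp C * ∫ τ in s..t, max (β τ) 0 := by
  set E : ℝ → ℝ := fun u ↦ Real.exp (∫ τ in t..u, α τ) with hE
  set Y : ℝ → ℝ := fun u ↦ (∫ τ in s..u, y' τ) + y s with hY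
  have hYy : ∀ u ∈ Set.Icc s t, Y u = y u := fun u hu ↦ by
    simp only [hY, ← hy u hu, sub_add_cancel]
  have hEac : AbsolutelyContinuousOnInterval E s t :=
    (hα.absolutelyContinuousOnInterval_intervalIntegral Set.right_mem_uIcc).exp
  have hYac : AbsolutelyContinuousOnInterval Y s t :=
    (hy'.absolutelyContinuousOnInterval_intervalIntegral Set.left_mem_uIcc).fun_add
      (LipschitzOnWith.absolutelyContinuousOnInterval
        (LipschitzWith.const (y s)).lipschitzOnWith)
  have hβp : IntervalIntegrable (fun u ↦ max (β u) 0) volume s t :=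
    ⟨hβ.1.pos_part, hβ.2.pos_part⟩
  have key := hYac.integral_deriv_mul_eq_sub hEac
  have hmono : ∫ u in s..t, deriv Y u * E u + Y u * deriv E u
      ≤ ∫ u in s..t, Real.exp C * max (β u) 0 := by
    refine intervalIntegral.integral_mono_ae_restrict hst
      ((hYac.intervalIntegrable_deriv.mul_continuousOn hEac.continuousOn).add
        (hEac.intervalIntegrable_deriv.continuousOn_mul hYac.continuousOn))
      (hβp.const_mul _) ?_
    rw [EventuallyLE, ae_restrict_iff' measurableSet_Icc]
    filter_upwards [hineq, hα.ae_hasDerivAt_integral, hy'.ae_hasDerivAt_integral]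
      with u hu hαu hyu hus
    have hus' : u ∈ Set.uIcc s t := by rwa [Set.uIcc_of_le hst]
    have hdE : HasDerivAt E (E u * α u) u := (hαu hus' t Set.right_mem_uIcc).exp
    have hdY : HasDerivAt Y (y' u) u := (hyu hus' s Set.left_mem_uIcc).add_const _
    have hEC : E u ≤ Real.exp C := by
      simp only [hE, Real.exp_le_exp]
      rw [intervalIntegral.integral_symm]
      exact hC u hus
    have hE0 : 0 ≤ E u := (Real.exp_pos _).le
    rw [hdE.deriv, hdY.deriv, hYy u hus]
    calc y' u * E u + y u * (E u * α u) = E u * (y' u + α u * y u) := by ring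
      _ ≤ E u * max (β u) 0 := by
        gcongr
        exact (hu hus).trans (le_max_left _ _)
      _ ≤ Real.exp C * max (β u) 0 := by gcongr
  rw [key, hYy t ⟨hst, le_rfl⟩, hYy s ⟨le_rfl, hst⟩, intervalIntegral.integral_const_mul] at hmono
  have hEt : E t = 1 := by simp [hE]
  have hEs : E s = Real.exp (-∫ τ in s..t, α τ) := by
    simp only [hE]
    rw [intervalIntegral.integral_symm]
  rw [hEt, hEs] at hmono
  linarith

/-- A nonnegative function that contracts, up to a vanishing error, along steps of length `T`
tends to zero. -/
theorem tendsto_zero_of_eventually_add_le_mul_add {T q : ℝ} (hT : 0 < T) (hq0 : 0 ≤ q)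
    (hq1 : q < 1) {y δ : ℝ → ℝ} (hy : ∀ᶠ t in atTop, 0 ≤ y t)
    (hbdd : ∀ᶠ a in atTop, BddAbove (y '' Set.Icc a (a + T)))
    (hδ : Tendsto δ atTop (nhds 0)) (hstep : ∀ᶠ s in atTop, y (s + T) ≤ q * y s + δ s) :
    Tendsto y atTop (nhds 0) := by
  refine tendsto_order.2 ⟨fun a ha ↦ hy.mono fun t ht ↦ ha.trans_le ht, fun ε hε ↦ ?_⟩
  have hδε : ∀ᶠ s in atTop, δ s < (1 - q) * (ε / 2) :=
    hδ.eventually_lt_const (mul_pos (by linarith) (by linarith))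
  obtain ⟨a, ⟨K, hK⟩, ha⟩ := (hbdd.and (eventually_forall_ge_atTop.2 (hstep.and hδε))).exists
  have hiter : ∀ n : ℕ, ∀ s ∈ Set.Icc a (a + T), y (s + n * T) ≤ q ^ n * K + ε / 2 := by
    intro n s hs
    induction n with
    | zero =>
      have := hK (Set.mem_image_of_mem y hs)
      simp only [Nat.cast_zero, zero_mul, add_zero, pow_zero, one_mul]
      linarith
    | succ n ih =>
      have hle : a ≤ s + n * T := by
        have : 0 ≤ n * T := by positivity
        linarith [hs.1]
      obtain ⟨h1, h2⟩ := ha _ hle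
      have h3 := mul_le_mul_of_nonneg_left ih hq0
      rw [show s + ((n + 1 : ℕ) : ℝ) * T = s + n * T + T by push_cast; ring, pow_succ]
      linarith
  have hpow : Tendsto (fun n : ℕ ↦ q ^ n * K) atTop (nhds 0) := by
    simpa using (tendsto_pow_atTop_nhds_zero_of_lt_one hq0 hq1).mul_const K
  obtain ⟨N, hN⟩ := eventually_atTop.1 (hpow.eventually_lt_const (half_pos hε))
  filter_upwards [eventually_ge_atTop (a + N * T)] with t ht
  have hr : (N : ℝ) ≤ (t - a) / T := by rw [le_div_iff₀ hT]; linarith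
  have hr0 : 0 ≤ (t - a) / T := (Nat.cast_nonneg N).trans hr
  have h1 := Nat.floor_le hr0
  have h2 := Nat.lt_floor_add_one ((t - a) / T)
  rw [le_div_iff₀ hT] at h1
  rw [div_lt_iff₀ hT] at h2
  have h3 := hiter ⌊(t - a) / T⌋₊ (t - ⌊(t - a) / T⌋₊ * T) ⟨by linarith, by linarith⟩
  rw [sub_add_cancel] at h3
  linarith [hN _ (Nat.le_floor hr)]

/-- Generalized Gronwall inequality (Lemma 4.2 / `lemma:gronwall_2`):
if the time-averages of `α` have positive liminf, the averages of `α⁻` have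
finite limsup, and the averages of `β⁺` tend to zero, then any nonnegative
absolutely continuous `y` with `y' + α y ≤ β` a.e. on `(0,∞)` tends to zero. -/
theorem generalized_gronwall
    (T : ℝ) (hT : 0 < T)
    (α β : ℝ → ℝ)
    (hα_loc : LocallyIntegrableOn α (Set.Ioi 0))
    (hβ_loc : LocallyIntegrableOn β (Set.Ioi 0))
    (m : ℝ) (hm : 0 < m)
    (hliminf : Filter.liminf (fun t => (1 / T) * ∫ τ in t..(t + T), α τ) Filter.atTop = m)
    (M : ℝ)
    (hbdd : IsBoundedUnder (· ≤ ·) atTop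
      (fun t => (1 / T) * ∫ τ in t..(t + T), max (-α τ) 0))
    (hlimsup : Filter.limsup (fun t => (1 / T) * ∫ τ in t..(t + T), max (-α τ) 0)
      Filter.atTop = M)
    (hβmean : Tendsto (fun t => (1 / T) * ∫ τ in t..(t + T), max (β τ) 0) atTop (nhds 0))
    (y y' : ℝ → ℝ)
    (hy_nonneg : ∀ t, 0 < t → 0 ≤ y t)
    (hy_int : ∀ s t, 0 < s → s ≤ t → IntervalIntegrable y' volume s t)
    (hy_ac : ∀ s t, 0 < s → s ≤ t → y t - y s = ∫ τ in s..t, y' τ)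
    (hineq : ∀ᵐ t ∂volume, t ∈ Set.Ioi (0:ℝ) → y' t + α t * y t ≤ β t) :
    Tendsto y atTop (nhds 0) := by
  have hii : ∀ {f : ℝ → ℝ}, LocallyIntegrableOn f (Set.Ioi 0) → ∀ s t, 0 < s → s ≤ t →
      IntervalIntegrable f volume s t := fun hf s t hs hst ↦ by
    rw [intervalIntegrable_iff_integrableOn_Icc_of_le hst]
    exact hf.integrableOn_compact_subset (fun u hu ↦ hs.trans_le hu.1) isCompact_Icc
  have hycont : ∀ s t, 0 < s → s ≤ t → ContinuousOn y (Set.Icc s t) := fun s t hs hst ↦ by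
    have h := intervalIntegral.continuousOn_primitive_interval' (hy_int s t hs hst)
      Set.left_mem_uIcc
    rw [Set.uIcc_of_le hst] at h
    refine (h.add_const (y s)).congr fun u hu ↦ ?_
    linarith [hy_ac s u hs hu.1]
  have hmean : ∀ᶠ t in atTop, m / 2 ≤ (1 / T) * ∫ τ in t..(t + T), α τ := by
    rw [liminf_eq] at hliminf
    have hne : {a | ∀ᶠ t in atTop, a ≤ (1 / T) * ∫ τ in t..(t + T), α τ}.Nonempty := by
      by_contra h
      rw [Set.not_nonempty_iff_eq_empty.1 h, Real.sSup_empty] at hliminf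
      exact hm.ne hliminf
    obtain ⟨a, ha, ham⟩ := exists_lt_of_lt_csSup hne (b := m / 2) (by rw [hliminf]; linarith)
    exact ha.mono fun t ht ↦ ham.le.trans ht
  obtain ⟨B, hB⟩ := hbdd
  rw [eventually_map] at hB
  have hδ : Tendsto (fun s ↦ Real.exp (T * B) * ∫ τ in s..(s + T), max (β τ) 0) atTop
      (nhds 0) := by
    have h := hβmean.const_mul (Real.exp (T * B) * T)
    rw [mul_zero] at h
    refine h.congr fun s ↦ ?_
    field_simp
  refine tendsto_zero_of_eventually_add_le_mul_add hT (Real.exp_pos (-(T * (m / 2)))).le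
    (Real.exp_lt_one_iff.2 (neg_lt_zero.2 (by positivity)))
    ((eventually_gt_atTop 0).mono hy_nonneg) ?_ hδ ?_
  · filter_upwards [eventually_gt_atTop 0] with a ha
    exact isCompact_Icc.bddAbove_image (hycont a (a + T) ha (by linarith))
  filter_upwards [hmean, hB, eventually_gt_atTop 0] with s hms hBs hs
  have hst : s ≤ s + T := by linarith
  have hαi := hii hα_loc s (s + T) hs hst
  have hαn : IntervalIntegrable (fun τ ↦ max (-α τ) 0) volume s (s + T) :=
    ⟨hαi.1.neg_part, hαi.2.neg_part⟩
  rw [one_div, ← div_eq_inv_mul, le_div_iff₀ hT] at hms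
  rw [one_div, ← div_eq_inv_mul, div_le_iff₀ hT] at hBs
  have hC : ∀ u ∈ Set.Icc s (s + T), -∫ τ in u..(s + T), α τ ≤ T * B := fun u hu ↦ by
    have hu' := hs.trans_le hu.1
    rw [← intervalIntegral.integral_neg]
    calc ∫ τ in u..(s + T), -α τ ≤ ∫ τ in u..(s + T), max (-α τ) 0 :=
          intervalIntegral.integral_mono_on hu.2 (hii hα_loc u _ hu' hu.2).neg
            (hαn.mono_set (Set.uIcc_subset_uIcc (by rwa [Set.uIcc_of_le hst])
              Set.right_mem_uIcc)) fun τ _ ↦ le_max_left _ _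
      _ ≤ ∫ τ in s..(s + T), max (-α τ) 0 :=
          intervalIntegral.integral_mono_interval hu.1 hu.2 le_rfl
            (Eventually.of_forall fun τ ↦ le_max_right _ _) hαn
      _ ≤ T * B := by linarith
  have h := le_exp_mul_add_of_ae_deriv_add_mul_le hst hαi (hii hβ_loc s _ hs hst)
    (hy_int s _ hs hst) (fun u hu ↦ hy_ac s u hs hu.1)
    (hineq.mono fun u hu hus ↦ hu (hs.trans_le hus.1)) hC
  have hexp : Real.exp (-∫ τ in s..(s + T), α τ) ≤ Real.exp (-(T * (m / 2))) :=
    Real.exp_le_exp.2 (by linarith)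
  have := mul_le_mul_of_nonneg_right hexp (hy_nonneg s hs)
  linarith
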